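/- The incompressible semi-geostrophic free boundary system — D_t u₁^g − u₂ + ∂p/∂x₁ = 0, D_t u₂^g + u₁ + ∂p/∂x₂ = 0, D_t ρ = 0, ∇·u = 0, ∂p/∂x₁ = u₂^g, ∂p/∂x₂ = −u₁^g, ∂p/∂x₃ = −ρ in the moving domain Ω_h(t), with boundary conditions u·n = 0 on the rigid part of the boundary, kinematic condition ∂ₜh + u₁ ∂h/∂x₁ + u₂ ∂h/∂x₂ = u₃ and p = 0 on the free surface x₃ = h(t,x₁,x₂) — conserves the geostrophic energy E = ∫_{Ω_h} ( ½((u₁^g)² + (u₂^g)²) + ρ x₃ ) dx, i.e. for sufficiently smooth solutions, dE/dt = 0. -/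

import Mathlib

open MeasureTheory Set Filter Topology
open scoped ENNReal NNReal

noncomputable section

abbrev E3 : Type := Fin 3 → ℝ
abbrev E2 : Type := Fin 2 → ℝ

/-- `i`-th partial derivative of `f : ℝ³ → ℝ`. -/
def pd (f : E3 → ℝ) (i : Fin 3) (x : E3) : ℝ := fderiv ℝ f x (Pi.single i 1)

/-- `i`-th partial derivative of `g : ℝ² → ℝ`. -/
def pd2 (g : E2 → ℝ) (i : Fin 2) (z : E2) : ℝ := fderiv ℝ g z (Pi.single i 1)

/-- Horizontal projection. -/
def proj2 (x : E3) : E2 := ![x 0, x 1]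

/-- The fluid domain `Ω_h = {x : (x₁,x₂) ∈ Ω₂, 0 ≤ x₃ ≤ h(x₁,x₂)}`. -/
def domH (Ω₂ : Set E2) (h : E2 → ℝ) : Set E3 :=
  {x | proj2 x ∈ Ω₂ ∧ 0 ≤ x 2 ∧ x 2 ≤ h (proj2 x)}

/-- The Lagrangian (material) derivative `D_t f = ∂ₜ f + u·∇f`. -/
def lagD (u : ℝ → E3 → E3) (f : ℝ → E3 → ℝ) (t : ℝ) (x : E3) : ℝ :=
  deriv (fun s => f s x) t + ∑ i, u t x i * pd (f t) i x


/-- Differentiation of a parametric integral of a `C¹` function over a bounded set. -/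
lemma hasFDerivAt_setIntegral_of_contDiff {P Y : Type*} [NormedAddCommGroup P] [NormedSpace ℝ P]
    [ProperSpace P] [NormedAddCommGroup Y] [NormedSpace ℝ Y] [ProperSpace Y]
    [MeasurableSpace Y] [BorelSpace Y] [SecondCountableTopology Y] (μ : Measure Y)
    [IsFiniteMeasureOnCompacts μ]
    {F : P × Y → ℝ} (hF : ContDiff ℝ 1 F) {K : Set Y} (hK : MeasurableSet K)
    (hKb : Bornology.IsBounded K) (x₀ : P) :
    HasFDerivAt (fun x => ∫ y in K, F (x, y) ∂μ)
      (∫ y in K, (fderiv ℝ F (x₀, y)).comp (ContinuousLinearMap.inl ℝ P Y) ∂μ) x₀ := by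
  have hKc : IsCompact (closure K) := hKb.isCompact_closure
  have hμK : μ K < ⊤ := (measure_mono subset_closure).trans_lt hKc.measure_lt_top
  have hcont : Continuous fun q : P × Y =>
      (fderiv ℝ F q).comp (ContinuousLinearMap.inl ℝ P Y) :=
    (hF.continuous_fderiv one_ne_zero).clm_comp continuous_const
  obtain ⟨C, hC⟩ := ((isCompact_closedBall x₀ 1).prod hKc).exists_bound_of_continuousOn
    hcont.continuousOn
  have hIntOn : ∀ x, IntegrableOn (fun y => F (x, y)) K μ := fun x =>
    (ContinuousOn.integrableOn_compact hKc
      (hF.continuous.comp (Continuous.prodMk_right x)).continuousOn).mono_set subset_closure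
  refine hasFDerivAt_integral_of_dominated_of_fderiv_le (bound := fun _ => C)
    (F := fun x y => F (x, y))
    (F' := fun x y => (fderiv ℝ F (x, y)).comp (ContinuousLinearMap.inl ℝ P Y))
    (Metric.closedBall_mem_nhds x₀ one_pos) ?_ (hIntOn x₀) ?_ ?_ ?_ ?_
  · exact Eventually.of_forall fun x => (hIntOn x).aestronglyMeasurable
  · exact (ContinuousOn.integrableOn_compact hKc
      (hcont.comp (Continuous.prodMk_right x₀)).continuousOn).mono_set
        subset_closure |>.aestronglyMeasurable
  · filter_upwards [ae_restrict_mem hK] with y hy x hx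
    exact hC (x, y) ⟨hx, subset_closure hy⟩
  · exact integrableOn_const hμK.ne
  · refine Eventually.of_forall fun y x _ => ?_
    exact ((hF.differentiable one_ne_zero).differentiableAt.hasFDerivAt).comp x
      (hasFDerivAt_prodMk_left x y)

/-- A parametric integral of a `C¹` function over a compact set is `C¹`. -/
lemma contDiff_one_setIntegral {P Y : Type*} [NormedAddCommGroup P] [NormedSpace ℝ P]
    [ProperSpace P] [NormedAddCommGroup Y] [NormedSpace ℝ Y] [ProperSpace Y]
    [MeasurableSpace Y] [BorelSpace Y] [SecondCountableTopology Y] (μ : Measure Y)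
    [IsFiniteMeasureOnCompacts μ]
    {F : P × Y → ℝ} (hF : ContDiff ℝ 1 F) {K : Set Y} (hK : IsCompact K) :
    ContDiff ℝ 1 (fun x => ∫ y in K, F (x, y) ∂μ) := by
  have hd := hasFDerivAt_setIntegral_of_contDiff μ hF hK.measurableSet hK.isBounded
  rw [contDiff_one_iff_fderiv]
  refine ⟨fun x => (hd x).differentiableAt, ?_⟩
  rw [show (fderiv ℝ fun x => ∫ y in K, F (x, y) ∂μ) = _ from funext fun x => (hd x).fderiv]
  refine continuous_parametric_integral_of_continuous ?_ hK
  exact (hF.continuous_fderiv one_ne_zero).clm_comp continuous_const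

/-- The integral of a `C¹` function from `0` to `y`, rescaled to the unit interval. -/
lemma integral_unit_rescale (g : ℝ → ℝ) (y : ℝ) :
    ∫ r in Icc (0 : ℝ) 1, y * g (y * r) = ∫ r in (0 : ℝ)..y, g r := by
  rw [integral_Icc_eq_integral_Ioc, ← intervalIntegral.integral_of_le zero_le_one,
    intervalIntegral.integral_const_mul, intervalIntegral.mul_integral_comp_mul_left]
  simp

/-- The Leibniz rule for `x ↦ ∫₀^{k x} f (x, r) dr`. -/
lemma contDiff_fderiv_integral_to {P : Type*} [NormedAddCommGroup P] [NormedSpace ℝ P]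
    [ProperSpace P] {f : P × ℝ → ℝ} (hf : ContDiff ℝ 1 f) {k : P → ℝ} (hk : ContDiff ℝ 1 k) :
    ContDiff ℝ 1 (fun x => ∫ r in (0 : ℝ)..k x, f (x, r)) ∧
    ∀ x v, fderiv ℝ (fun x => ∫ r in (0 : ℝ)..k x, f (x, r)) x v =
      (∫ r in (0 : ℝ)..k x, fderiv ℝ f (x, r) (v, 0)) + f (x, k x) * fderiv ℝ k x v := by
  set H : (P × ℝ) × ℝ → ℝ := fun q => q.1.2 * f (q.1.1, q.1.2 * q.2) with hH
  have hHc : ContDiff ℝ 1 H := by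
    refine (contDiff_snd.comp contDiff_fst).mul (hf.comp ?_)
    exact (contDiff_fst.comp contDiff_fst).prodMk
      ((contDiff_snd.comp contDiff_fst).mul contDiff_snd)
  set Φ : P × ℝ → ℝ := fun a => ∫ r in Icc (0 : ℝ) 1, H (a, r) with hΦ
  have hΦeq : ∀ x y, Φ (x, y) = ∫ r in (0 : ℝ)..y, f (x, r) := fun x y =>
    integral_unit_rescale (fun r => f (x, r)) y
  have hΦc : ContDiff ℝ 1 Φ := contDiff_one_setIntegral volume hHc isCompact_Icc
  have hΦd := hasFDerivAt_setIntegral_of_contDiff volume hHc measurableSet_Icc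
    (Metric.isBounded_Icc (0 : ℝ) 1)
  have hcomp : (fun x => ∫ r in (0 : ℝ)..k x, f (x, r)) = fun x => Φ (x, k x) := by
    funext x; rw [hΦeq]
  have hfd : Differentiable ℝ f := hf.differentiable one_ne_zero
  have h1 : ∀ x y v, fderiv ℝ Φ (x, y) (v, 0) = ∫ r in (0 : ℝ)..y, fderiv ℝ f (x, r) (v, 0) := by
    intro x y v
    rw [(hΦd (x, y)).fderiv, ContinuousLinearMap.integral_apply]
    · rw [← integral_unit_rescale (fun r => fderiv ℝ f (x, r) (v, 0)) y]
      refine integral_congr_ae (Eventually.of_forall fun r => ?_)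
      have hline : HasDerivAt (fun s : ℝ => H ((x + s • v, y), r))
          (y * fderiv ℝ f (x, y * r) (v, 0)) 0 := by
        have hl : HasDerivAt (fun s : ℝ => ((x + s • v, y * r) : P × ℝ)) (v, 0) 0 := by
          have := ((hasDerivAt_id (0 : ℝ)).smul_const v).const_add x
          simpa using this.prodMk (hasDerivAt_const (0 : ℝ) (y * r))
        have := (hfd (x + (0 : ℝ) • v, y * r)).hasFDerivAt.comp_hasDerivAt (0 : ℝ) hl
        simpa using this.const_mul y
      have hline' : HasDerivAt (fun s : ℝ => H ((x + s • v, y), r))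
          (fderiv ℝ H ((x, y), r) ((v, 0), 0)) 0 := by
        have hl : HasDerivAt (fun s : ℝ => (((x + s • v, y), r) : (P × ℝ) × ℝ)) ((v, 0), 0) 0 := by
          have := ((hasDerivAt_id (0 : ℝ)).smul_const v).const_add x
          simpa using (this.prodMk (hasDerivAt_const (0 : ℝ) y)).prodMk
            (hasDerivAt_const (0 : ℝ) r)
        have := ((hHc.differentiable one_ne_zero)
          ((x + (0 : ℝ) • v, y), r)).hasFDerivAt.comp_hasDerivAt (0 : ℝ) hl
        simpa [Function.comp_def] using this
      simpa using hline'.unique hline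
    · refine ContinuousOn.integrableOn_compact isCompact_Icc (Continuous.continuousOn ?_)
      exact ((hHc.continuous_fderiv one_ne_zero).comp (Continuous.prodMk_right _)).clm_comp
        continuous_const
  have h2 : ∀ x y, fderiv ℝ Φ (x, y) (0, 1) = f (x, y) := by
    intro x y
    have ha : HasDerivAt (fun s => Φ (x, s)) (fderiv ℝ Φ (x, y) (0, 1)) y :=
      ((hΦc.differentiable one_ne_zero) (x, y)).hasFDerivAt.comp_hasDerivAt y
        ((hasDerivAt_const y x).prodMk (hasDerivAt_id y))
    have hc : Continuous fun r => f (x, r) := hf.continuous.comp (Continuous.prodMk_right x)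
    have hb : HasDerivAt (fun s => Φ (x, s)) (f (x, y)) y := by
      simp only [hΦeq]
      exact intervalIntegral.integral_hasDerivAt_right (hc.intervalIntegrable _ _)
        (hc.stronglyMeasurableAtFilter _ _) hc.continuousAt
    exact ha.unique hb
  rw [hcomp]
  refine ⟨hΦc.comp (contDiff_id.prodMk hk), fun x v => ?_⟩
  have hch : HasFDerivAt (fun x => Φ (x, k x)) _ x :=
    HasFDerivAt.comp (g := Φ) (f := fun x => (x, k x)) x ((hΦc.differentiable one_ne_zero) (x, k x)).hasFDerivAt
      ((hasFDerivAt_id x).prodMk ((hk.differentiable one_ne_zero) x).hasFDerivAt)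
  rw [hch.fderiv]
  have hsplit : ((v, fderiv ℝ k x v) : P × ℝ) = (v, 0) + fderiv ℝ k x v • ((0, 1) : P × ℝ) := by
    simp
  simp only [ContinuousLinearMap.comp_apply, ContinuousLinearMap.prod_apply,
    ContinuousLinearMap.id_apply]
  rw [hsplit, map_add, map_smul, h1, h2, smul_eq_mul, mul_comm]

/-- If a `C¹` vector field points strictly outwards along the boundary of the bounded domain
`{g < 0}`, the integral of its divergence over the domain is nonnegative. -/
lemma setIntegral_div_nonneg_of_outward {Ω : Set E2} {g : E2 → ℝ}
    (hΩb : Bornology.IsBounded Ω) (hg : ContDiff ℝ 1 g)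
    (hgΩ : Ω = {z | g z < 0}) (hgfr : frontier Ω = {z | g z = 0})
    {W : Fin 2 → E2 → ℝ} (hW : ∀ i, ContDiff ℝ 1 (W i))
    (hout : ∀ z ∈ frontier Ω, 0 < ∑ i, W i z * pd2 g i z) :
    0 ≤ ∫ z in Ω, ∑ i, pd2 (W i) i z := by
  have hΩo : IsOpen Ω := hgΩ ▸ isOpen_lt hg.continuous continuous_const
  have hKc : IsCompact (closure Ω) := hΩb.isCompact_closure
  have hpdc : ∀ (f : E2 → ℝ), ContDiff ℝ 1 f → ∀ i, Continuous (pd2 f i) := fun f hf i =>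
    (hf.continuous_fderiv one_ne_zero).clm_apply continuous_const
  have hdivc : Continuous fun z => ∑ i, pd2 (W i) i z :=
    continuous_finsetSum _ fun i _ => hpdc _ (hW i) i
  have hflux : Continuous fun z => ∑ i, W i z * pd2 g i z :=
    continuous_finsetSum _ fun i _ => (hW i).continuous.mul (hpdc _ hg i)
  set χ : ℕ → E2 → ℝ := fun n z => Real.smoothTransition (-(n * g z)) with hχ
  have hχd : ∀ n, ContDiff ℝ 1 (χ n) := fun n =>
    Real.smoothTransition.contDiff.comp (contDiff_const.mul hg).neg
  have hχ0 : ∀ n z, z ∉ Ω → χ n z = 0 := by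
    intro n z hz
    apply Real.smoothTransition.zero_of_nonpos
    have : 0 ≤ g z := by simpa [hgΩ] using hz
    have := mul_nonneg (Nat.cast_nonneg (α := ℝ) n) this
    linarith
  have hχs : ∀ n, HasCompactSupport (χ n) := fun n =>
    HasCompactSupport.intro hKc fun z hz => hχ0 n z fun h => hz (subset_closure h)
  have hσm : ∀ x, 0 ≤ deriv Real.smoothTransition x := fun x =>
    Real.smoothTransition.monotone.deriv_nonneg
  have hχpd : ∀ n i z, pd2 (χ n) i z
      = -(n * deriv Real.smoothTransition (-(n * g z)) * pd2 g i z) := by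
    intro n i z
    have hs : DifferentiableAt ℝ Real.smoothTransition (-(n * g z)) :=
      (Real.smoothTransition.contDiff (n := 1)).differentiable one_ne_zero _
    have := hs.hasDerivAt.comp_hasFDerivAt z
      ((((hg.differentiable one_ne_zero) z).hasFDerivAt.const_mul (n : ℝ)).neg)
    have h' : HasFDerivAt (χ n) _ z := this
    simp only [pd2, h'.fderiv]
    simp
    ring
  have hparts : ∀ n, ∫ z, χ n z * ∑ i, pd2 (W i) i z
      = ∫ z, n * deriv Real.smoothTransition (-(n * g z)) * ∑ i, W i z * pd2 g i z := by
    intro n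
    have hI1 : ∀ i, Integrable (fun z => χ n z * pd2 (W i) i z) := fun i =>
      ((hχd n).continuous.mul (hpdc _ (hW i) i)).integrable_of_hasCompactSupport (hχs n).mul_right
    have hI2 : ∀ i, Integrable (fun z => pd2 (χ n) i z * W i z) := fun i =>
      ((hpdc _ (hχd n) i).mul (hW i).continuous).integrable_of_hasCompactSupport
        (((hχs n).fderiv_apply ℝ _).mul_right)
    have hI3 : ∀ i, Integrable (fun z => χ n z * W i z) := fun i =>
      ((hχd n).continuous.mul (hW i).continuous).integrable_of_hasCompactSupport (hχs n).mul_right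
    have hi : ∀ i, ∫ z, χ n z * pd2 (W i) i z = -∫ z, pd2 (χ n) i z * W i z := fun i =>
      integral_mul_fderiv_eq_neg_fderiv_mul_of_integrable (hI2 i) (hI1 i) (hI3 i)
        (fun z _ => (hχd n).differentiable one_ne_zero z)
        (fun z _ => (hW i).differentiable one_ne_zero z)
    simp_rw [Finset.mul_sum]
    rw [integral_finsetSum _ fun i _ => hI1 i]
    simp_rw [hi]
    rw [Finset.sum_neg_distrib, ← integral_finsetSum _ fun i _ => hI2 i, ← integral_neg]
    congr 1; funext z
    rw [← Finset.sum_neg_distrib]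
    refine Finset.sum_congr rfl fun i _ => ?_
    rw [hχpd]; ring
  have hev : ∀ᶠ n : ℕ in atTop, 0 ≤ ∫ z, χ n z * ∑ i, pd2 (W i) i z := by
    obtain ⟨δ, hδ, hδK⟩ : ∃ δ > 0, ∀ z ∈ closure Ω, ∑ i, W i z * pd2 g i z ≤ 0 → g z ≤ -δ := by
      set K := closure Ω ∩ {z | ∑ i, W i z * pd2 g i z ≤ 0} with hK
      have hKcomp : IsCompact K := hKc.inter_right (isClosed_le hflux continuous_const)
      rcases K.eq_empty_or_nonempty with he | hne
      · refine ⟨1, one_pos, fun z hz hz' => ?_⟩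
        have : z ∈ K := ⟨hz, hz'⟩
        simp [he] at this
      · obtain ⟨z₀, hz₀, hmax⟩ := hKcomp.exists_isMaxOn hne hg.continuous.continuousOn
        have hneg : g z₀ < 0 := by
          have : z₀ ∈ Ω := by
            by_contra hn
            have hf : z₀ ∈ frontier Ω := by
              rw [hΩo.frontier_eq]; exact ⟨hz₀.1, hn⟩
            exact absurd (hout z₀ hf) (not_lt.2 hz₀.2)
          simpa [hgΩ] using this
        exact ⟨-g z₀, by linarith, fun z hz hz' => by
          have := hmax (show z ∈ K from ⟨hz, hz'⟩); simpa using this⟩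
    obtain ⟨N, hN⟩ := exists_nat_gt (1 / δ)
    filter_upwards [eventually_ge_atTop N] with n hn
    rw [hparts]
    refine integral_nonneg fun z => ?_
    have hn' : 1 < n * δ := by
      rw [div_lt_iff₀ hδ] at hN
      have : (N : ℝ) ≤ n := by exact_mod_cast hn
      nlinarith
    have hzero : ∀ y : ℝ, y < 0 ∨ 1 < y → deriv Real.smoothTransition y = 0 := by
      rintro y (hy | hy)
      · have : Real.smoothTransition =ᶠ[𝓝 y] fun _ => 0 := by
          filter_upwards [Iio_mem_nhds hy] with x hx
          exact Real.smoothTransition.zero_of_nonpos (le_of_lt hx)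
        rw [this.deriv_eq]; simp
      · have : Real.smoothTransition =ᶠ[𝓝 y] fun _ => 1 := by
          filter_upwards [Ioi_mem_nhds hy] with x hx
          exact Real.smoothTransition.one_of_one_le (le_of_lt hx)
        rw [this.deriv_eq]; simp
    have hn0 : (0 : ℝ) < n := by
      by_contra hcon
      nlinarith
    show 0 ≤ n * deriv Real.smoothTransition (-(n * g z)) * ∑ i, W i z * pd2 g i z
    by_cases hpos : 0 ≤ ∑ i, W i z * pd2 g i z
    · exact mul_nonneg (mul_nonneg hn0.le (hσm _)) hpos
    · rw [hzero, mul_zero, zero_mul]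
      by_cases hz : z ∈ closure Ω
      · right
        have := hδK z hz (le_of_not_ge hpos)
        nlinarith
      · left
        have h1 : 0 ≤ g z := by
          have : z ∉ Ω := fun h => hz (subset_closure h)
          simpa [hgΩ] using this
        have h2 : g z ≠ 0 := by
          intro h0
          have : z ∈ frontier Ω := by rw [hgfr]; exact h0
          exact hz (frontier_subset_closure this)
        have h3 : 0 < g z := lt_of_le_of_ne h1 h2.symm
        have := mul_pos hn0 h3
        linarith
  have hlim : Tendsto (fun n : ℕ => ∫ z, χ n z * ∑ i, pd2 (W i) i z) atTop
      (𝓝 (∫ z in Ω, ∑ i, pd2 (W i) i z)) := by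
    rw [← integral_indicator hΩo.measurableSet]
    have hIntOnΩ : IntegrableOn (fun z => ∑ i, pd2 (W i) i z) Ω :=
      (hdivc.continuousOn.integrableOn_compact hKc).mono_set subset_closure
    refine tendsto_integral_of_dominated_convergence
      (Ω.indicator fun z => ‖∑ i, pd2 (W i) i z‖) ?_ ?_ ?_ ?_
    · exact fun n => ((hχd n).continuous.mul hdivc).aestronglyMeasurable
    · exact (integrable_indicator_iff hΩo.measurableSet).2 hIntOnΩ.norm
    · refine fun n => Eventually.of_forall fun z => ?_
      by_cases hz : z ∈ Ω
      · rw [indicator_of_mem hz, norm_mul]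
        refine mul_le_of_le_one_left (norm_nonneg _) ?_
        rw [Real.norm_of_nonneg (Real.smoothTransition.nonneg _)]
        exact Real.smoothTransition.le_one _
      · simp [hz, hχ0 n z hz]
    · refine Eventually.of_forall fun z => ?_
      by_cases hz : z ∈ Ω
      · rw [indicator_of_mem hz]
        have hgz : g z < 0 := by simpa [hgΩ] using hz
        obtain ⟨N, hN⟩ := exists_nat_gt (1 / (-g z))
        refine tendsto_const_nhds.congr' ?_
        filter_upwards [eventually_ge_atTop N] with n hn
        have h1 : χ n z = 1 := by
          apply Real.smoothTransition.one_of_one_le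
          rw [div_lt_iff₀ (by linarith)] at hN
          have : (N : ℝ) ≤ n := by exact_mod_cast hn
          nlinarith
        rw [h1, one_mul]
      · simp [hz, hχ0 _ z hz]
  exact ge_of_tendsto hlim hev

/-- A nondegenerate `C¹` boundary admits a smooth strictly outward field. -/
lemma exists_contDiff_outward {S : Set E2} (hS : IsClosed S) {g : E2 → ℝ} (hg : ContDiff ℝ 1 g)
    (hnd : ∀ z ∈ S, ∃ i : Fin 2, pd2 g i z ≠ 0) :
    ∃ V : Fin 2 → E2 → ℝ, (∀ i, ContDiff ℝ 1 (V i)) ∧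
      ∀ z ∈ S, 0 < ∑ i, V i z * pd2 g i z := by
  have hpdc : ∀ i, Continuous (pd2 g i) := fun i =>
    (hg.continuous_fderiv one_ne_zero).clm_apply continuous_const
  obtain ⟨V, hV⟩ := exists_contMDiffMap_forall_mem_convex_of_local_const (n := 1)
    (modelWithCornersSelf ℝ E2) (F := E2)
    (t := fun z => {v | z ∈ S → 0 < ∑ i, v i * pd2 g i z}) (by
      intro z v hv w hw a b ha hb hab hz
      have h1 := hv hz
      have h2 := hw hz
      simp only [Fin.sum_univ_two, Pi.add_apply, Pi.smul_apply, smul_eq_mul] at h1 h2 ⊢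
      rcases ha.eq_or_lt with rfl | ha'
      · obtain rfl : b = 1 := by linarith
        linarith
      · nlinarith [mul_pos ha' h1, mul_nonneg hb h2.le]) (by
      intro z
      by_cases hz : z ∈ S
      · refine ⟨fun i => pd2 g i z, ?_⟩
        have hc : Continuous fun y => ∑ i, pd2 g i z * pd2 g i y :=
          continuous_finsetSum _ fun i _ => continuous_const.mul (hpdc i)
        have hp : 0 < ∑ i, pd2 g i z * pd2 g i z := by
          obtain ⟨i, hi⟩ := hnd z hz
          exact Finset.sum_pos' (fun j _ => mul_self_nonneg _)
            ⟨i, Finset.mem_univ i, mul_self_pos.2 hi⟩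
        filter_upwards [hc.continuousAt.eventually (lt_mem_nhds hp)] with y hy _ using hy
      · refine ⟨0, ?_⟩
        filter_upwards [hS.isOpen_compl.mem_nhds hz] with y hy hy' using absurd hy' hy)
  refine ⟨fun i z => V z i, fun i => ?_, fun z hz => hV z hz⟩
  exact (contDiff_pi.1 V.contMDiff.contDiff) i

/-- The divergence theorem for a `C¹` vector field tangent to the boundary. -/
lemma setIntegral_div_eq_zero_of_tangent {Ω : Set E2} {g : E2 → ℝ}
    (hΩb : Bornology.IsBounded Ω) (hg : ContDiff ℝ 1 g)
    (hgΩ : Ω = {z | g z < 0}) (hgfr : frontier Ω = {z | g z = 0})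
    (hnd : ∀ z ∈ frontier Ω, ∃ i : Fin 2, pd2 g i z ≠ 0)
    {G : Fin 2 → E2 → ℝ} (hG : ∀ i, ContDiff ℝ 1 (G i))
    (htan : ∀ z ∈ frontier Ω, ∑ i, G i z * pd2 g i z = 0) :
    ∫ z in Ω, ∑ i, pd2 (G i) i z = 0 := by
  obtain ⟨V, hV, hVout⟩ := exists_contDiff_outward isClosed_frontier hg hnd
  have hIntOn : ∀ F : Fin 2 → E2 → ℝ, (∀ i, ContDiff ℝ 1 (F i)) →
      IntegrableOn (fun z => ∑ i, pd2 (F i) i z) Ω := by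
    intro F hF
    have hc : Continuous fun z => ∑ i, pd2 (F i) i z := continuous_finsetSum _ fun i _ =>
      ((hF i).continuous_fderiv one_ne_zero).clm_apply continuous_const
    exact (hc.continuousOn.integrableOn_compact hΩb.isCompact_closure).mono_set subset_closure
  have key : ∀ η : ℝ, 0 < η → ∀ c : ℝ,
      0 ≤ η * (∫ z in Ω, ∑ i, pd2 (V i) i z) + c * ∫ z in Ω, ∑ i, pd2 (G i) i z := by
    intro η hη c
    have h := setIntegral_div_nonneg_of_outward hΩb hg hgΩ hgfr
      (W := fun i z => η * V i z + c * G i z)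
      (fun i => (contDiff_const.mul (hV i)).add (contDiff_const.mul (hG i))) (by
        intro z hz
        have h1 := mul_pos hη (hVout z hz)
        have h2 := htan z hz
        simp only [Fin.sum_univ_two] at h1 h2 ⊢
        linear_combination h1 - c * h2)
    rw [← integral_const_mul, ← integral_const_mul,
      ← integral_add ((hIntOn V hV).const_mul η) ((hIntOn G hG).const_mul c)]
    refine h.trans_eq (integral_congr_ae (Eventually.of_forall fun z => ?_))
    simp only [Finset.mul_sum]
    rw [← Finset.sum_add_distrib]
    refine Finset.sum_congr rfl fun i _ => ?_
    have hd := (((hV i).differentiable one_ne_zero z).hasFDerivAt.const_mul η).add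
      (((hG i).differentiable one_ne_zero z).hasFDerivAt.const_mul c)
    have hd' : HasFDerivAt (fun z => η * V i z + c * G i z) _ z := hd
    simp only [pd2, hd'.fderiv]
    simp
  have hlim : ∀ c : ℝ, 0 ≤ c * ∫ z in Ω, ∑ i, pd2 (G i) i z := by
    intro c
    have ht : Tendsto (fun η : ℝ => η * (∫ z in Ω, ∑ i, pd2 (V i) i z)
        + c * ∫ z in Ω, ∑ i, pd2 (G i) i z) (𝓝[>] 0)
        (𝓝 (0 * (∫ z in Ω, ∑ i, pd2 (V i) i z) + c * ∫ z in Ω, ∑ i, pd2 (G i) i z)) :=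
      ((tendsto_id.mono_left nhdsWithin_le_nhds).mul_const _).add_const _
    rw [zero_mul, zero_add] at ht
    exact ge_of_tendsto ht (eventually_mem_nhdsWithin.mono fun η hη => key η hη c)
  have h1 := hlim 1
  have h2 := hlim (-1)
  linarith

/-- The linear map `((z₁, z₂), r) ↦ (z₁, z₂, r)`. -/
def vertLift : E2 × ℝ →L[ℝ] E3 :=
  ContinuousLinearMap.pi ![(ContinuousLinearMap.proj 0).comp (ContinuousLinearMap.fst ℝ E2 ℝ),
    (ContinuousLinearMap.proj 1).comp (ContinuousLinearMap.fst ℝ E2 ℝ),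
    ContinuousLinearMap.snd ℝ E2 ℝ]

lemma vertLift_apply (z : E2) (r : ℝ) : vertLift (z, r) = ![z 0, z 1, r] := by
  funext i; fin_cases i <;> rfl

lemma proj2_vertLift (z : E2) (r : ℝ) : proj2 (vertLift (z, r)) = z := by
  funext i; fin_cases i <;> rfl

lemma vertLift_two (z : E2) (r : ℝ) : vertLift (z, r) 2 = r := rfl

lemma vertLift_single_zero : vertLift (Pi.single 0 1, 0) = Pi.single 0 1 := by
  funext i; fin_cases i <;> simp [vertLift_apply]

lemma vertLift_single_one : vertLift (Pi.single 1 1, 0) = Pi.single 1 1 := by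
  funext i; fin_cases i <;> simp [vertLift_apply]

lemma vertLift_zero_one : vertLift (0, 1) = Pi.single 2 1 := by
  funext i; fin_cases i <;> simp [vertLift_apply]

lemma fderiv_comp_vertLift {f : E3 → ℝ} (hf : Differentiable ℝ f) (q v : E2 × ℝ) :
    fderiv ℝ (fun q => f (vertLift q)) q v = fderiv ℝ f (vertLift q) (vertLift v) := by
  have h : HasFDerivAt (fun q => f (vertLift q)) _ q :=
    (hf (vertLift q)).hasFDerivAt.comp q vertLift.hasFDerivAt
  rw [h.fderiv]; rfl

lemma setIntegral_domH_eq {Ω : Set E2} (hΩo : IsOpen Ω) (hΩb : Bornology.IsBounded Ω)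
    {k : E2 → ℝ} (hk : Continuous k) (hk0 : ∀ z, 0 ≤ k z) {e : E3 → ℝ} (he : Continuous e) :
    ∫ x in domH Ω k, e x = ∫ z in Ω, ∫ r in (0 : ℝ)..k z, e (vertLift (z, r)) := by
  have hp2 : Continuous proj2 := by
    refine continuous_pi fun i => ?_
    fin_cases i
    · exact continuous_apply (0 : Fin 3)
    · exact continuous_apply (1 : Fin 3)
  set S : Set (E2 × ℝ) := {q | q.1 ∈ Ω ∧ 0 ≤ q.2 ∧ q.2 ≤ k q.1} with hS
  have hSm : MeasurableSet S := by
    refine (hΩo.preimage continuous_fst).measurableSet.inter (IsClosed.measurableSet ?_)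
    exact (isClosed_le continuous_const continuous_snd).inter
      (isClosed_le continuous_snd (hk.comp continuous_fst))
  obtain ⟨C, hC⟩ := hΩb.isCompact_closure.exists_bound_of_continuousOn hk.continuousOn
  have hSsub : S ⊆ closure Ω ×ˢ Icc 0 C := fun q hq =>
    ⟨subset_closure hq.1, hq.2.1, hq.2.2.trans
      ((le_abs_self _).trans (hC q.1 (subset_closure hq.1)))⟩
  have heL : Continuous fun q : E2 × ℝ => e (vertLift q) := he.comp vertLift.continuous
  have hSint : IntegrableOn (fun q : E2 × ℝ => e (vertLift q)) S :=
    (heL.continuousOn.integrableOn_compact (hΩb.isCompact_closure.prod isCompact_Icc)).mono_set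
      hSsub
  have hmp : MeasurePreserving
      ((MeasurableEquiv.piFinSuccAbove (fun _ : Fin 3 => ℝ) 2).trans MeasurableEquiv.prodComm) :=
    (volume_preserving_piFinSuccAbove (fun _ : Fin 3 => ℝ) 2).trans
      Measure.measurePreserving_swap
  have hpt : ∀ x : E3, ((MeasurableEquiv.piFinSuccAbove (fun _ : Fin 3 => ℝ) 2).trans
      MeasurableEquiv.prodComm) x = (proj2 x, x 2) := by
    intro x
    refine Prod.ext ?_ rfl
    funext i; fin_cases i <;> rfl
  have hL : ∀ x : E3, vertLift (proj2 x, x 2) = x := by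
    intro x; funext i; fin_cases i <;> rfl
  have h1 : ∫ x in domH Ω k, e x = ∫ q in S, e (vertLift q) := by
    rw [← hmp.setIntegral_preimage_emb (MeasurableEquiv.measurableEmbedding _)]
    have hpre : ((MeasurableEquiv.piFinSuccAbove (fun _ : Fin 3 => ℝ) 2).trans
      MeasurableEquiv.prodComm) ⁻¹' S = domH Ω k := by
      ext x
      rw [mem_preimage, hpt]; rfl
    rw [hpre]
    simp only [hpt, hL]
  rw [h1, ← integral_indicator hSm, Measure.volume_eq_prod,
    integral_prod _ ((integrable_indicator_iff hSm).2 hSint), ← integral_indicator hΩo.measurableSet]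
  congr 1; funext z
  by_cases hz : z ∈ Ω
  · rw [indicator_of_mem hz, intervalIntegral.integral_of_le (hk0 z),
      ← integral_Icc_eq_integral_Ioc, ← integral_indicator measurableSet_Icc]
    congr 1; funext r
    by_cases hr : r ∈ Icc 0 (k z)
    · rw [indicator_of_mem hr, indicator_of_mem (show (z, r) ∈ S from ⟨hz, hr⟩)]
    · rw [indicator_of_notMem hr, indicator_of_notMem (fun h : (z, r) ∈ S => hr h.2)]
  · rw [indicator_of_notMem hz]
    have : ∀ r, S.indicator (fun q => e (vertLift q)) (z, r) = 0 := fun r =>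
      indicator_of_notMem (fun h : (z, r) ∈ S => hz h.1) _
    simp [this]

/-- The geostrophic energy density `½((u₁ᵍ)² + (u₂ᵍ)²) + ρ x₃`. -/
def geoEnergyDensity (ug1 ug2 ρ : ℝ → E3 → ℝ) (s : ℝ) (x : E3) : ℝ :=
  (1/2) * ((ug1 s x)^2 + (ug2 s x)^2) + ρ s x * x 2

lemma contDiff_geoEnergyDensity {ug1 ug2 ρ : ℝ → E3 → ℝ}
    (hug1 : ContDiff ℝ 1 (fun q : ℝ × E3 => ug1 q.1 q.2))
    (hug2 : ContDiff ℝ 1 (fun q : ℝ × E3 => ug2 q.1 q.2))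
    (hρ : ContDiff ℝ 1 (fun q : ℝ × E3 => ρ q.1 q.2)) :
    ContDiff ℝ 1 (fun q : ℝ × E3 => geoEnergyDensity ug1 ug2 ρ q.1 q.2) := by
  have h2 : ContDiff ℝ 1 (fun q : ℝ × E3 => q.2 2) :=
    (contDiff_apply ℝ ℝ (2 : Fin 3)).comp contDiff_snd
  exact (contDiff_const.mul ((hug1.pow 2).add (hug2.pow 2))).add (hρ.mul h2)

lemma contDiff_slice_left {P Q : Type*} [NormedAddCommGroup P] [NormedSpace ℝ P]
    [NormedAddCommGroup Q] [NormedSpace ℝ Q] {w : P → Q → ℝ}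
    (hw : ContDiff ℝ 1 (fun q : P × Q => w q.1 q.2)) (x : Q) : ContDiff ℝ 1 (fun s => w s x) :=
  hw.comp (contDiff_id.prodMk contDiff_const)

lemma contDiff_slice_right {P Q : Type*} [NormedAddCommGroup P] [NormedSpace ℝ P]
    [NormedAddCommGroup Q] [NormedSpace ℝ Q] {w : P → Q → ℝ}
    (hw : ContDiff ℝ 1 (fun q : P × Q => w q.1 q.2)) (t : P) : ContDiff ℝ 1 (w t) :=
  hw.comp (contDiff_const.prodMk contDiff_id)

lemma fderiv_time_eq_deriv {Q : Type*} [NormedAddCommGroup Q] [NormedSpace ℝ Q]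
    {w : ℝ → Q → ℝ} (hw : ContDiff ℝ 1 (fun q : ℝ × Q => w q.1 q.2)) (t : ℝ) (x : Q) :
    fderiv ℝ (fun q : ℝ × Q => w q.1 q.2) (t, x) (1, 0) = deriv (fun s => w s x) t := by
  have h : HasDerivAt (fun s => w s x) _ t :=
    HasFDerivAt.comp_hasDerivAt (l := fun q : ℝ × Q => w q.1 q.2) t
      ((hw.differentiable one_ne_zero) (t, x)).hasFDerivAt
      ((hasDerivAt_id t).prodMk (hasDerivAt_const t x))
  exact h.deriv.symm

/-- The local energy balance `∂ₜ e + ∇·((p + e) u) = 0`. -/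
lemma geoEnergyDensity_balance {u : ℝ → E3 → E3} {ug1 ug2 p ρ : ℝ → E3 → ℝ}
    (hu : ∀ i : Fin 3, ContDiff ℝ 1 (fun q : ℝ × E3 => u q.1 q.2 i))
    (hug1 : ContDiff ℝ 1 (fun q : ℝ × E3 => ug1 q.1 q.2))
    (hug2 : ContDiff ℝ 1 (fun q : ℝ × E3 => ug2 q.1 q.2))
    (hp : ContDiff ℝ 1 (fun q : ℝ × E3 => p q.1 q.2))
    (hρ : ContDiff ℝ 1 (fun q : ℝ × E3 => ρ q.1 q.2)) {t : ℝ} {x : E3}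
    (heq1 : lagD u ug1 t x - u t x 1 + pd (p t) 0 x = 0)
    (heq2 : lagD u ug2 t x + u t x 0 + pd (p t) 1 x = 0)
    (heq3 : lagD u ρ t x = 0)
    (heq4 : (∑ i, pd (fun y => u t y i) i x) = 0)
    (heq5 : pd (p t) 0 x = ug2 t x ∧ pd (p t) 1 x = -(ug1 t x) ∧ pd (p t) 2 x = -(ρ t x)) :
    deriv (fun s => geoEnergyDensity ug1 ug2 ρ s x) t +
      ∑ i, pd (fun y => (p t y + geoEnergyDensity ug1 ug2 ρ t y) * u t y i) i x = 0 := by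
  have dt : ∀ {w : ℝ → E3 → ℝ}, ContDiff ℝ 1 (fun q : ℝ × E3 => w q.1 q.2) →
      HasDerivAt (fun s => w s x) (deriv (fun s => w s x) t) t := fun hw =>
    ((contDiff_slice_left hw x).differentiable one_ne_zero t).hasDerivAt
  have dx : ∀ {w : ℝ → E3 → ℝ}, ContDiff ℝ 1 (fun q : ℝ × E3 => w q.1 q.2) →
      HasFDerivAt (w t) (fderiv ℝ (w t) x) x := fun hw =>
    ((contDiff_slice_right hw t).differentiable one_ne_zero x).hasFDerivAt
  have het : deriv (fun s => geoEnergyDensity ug1 ug2 ρ s x) t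
      = ug1 t x * deriv (fun s => ug1 s x) t + ug2 t x * deriv (fun s => ug2 s x) t
        + deriv (fun s => ρ s x) t * x 2 := by
    have h : HasDerivAt (fun s => geoEnergyDensity ug1 ug2 ρ s x) _ t :=
      ((((dt hug1).pow 2).add ((dt hug2).pow 2)).const_mul (1/2)).add ((dt hρ).mul_const (x 2))
    rw [h.deriv]; simp; ring
  have hx2 : HasFDerivAt (fun y : E3 => y 2) (ContinuousLinearMap.proj (R := ℝ) 2) x :=
    hasFDerivAt_apply 2 x
  have hpd : ∀ i, pd (fun y => (p t y + geoEnergyDensity ug1 ug2 ρ t y) * u t y i) i x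
      = (p t x + geoEnergyDensity ug1 ug2 ρ t x) * pd (fun y => u t y i) i x
        + u t x i * (pd (p t) i x + ug1 t x * pd (ug1 t) i x + ug2 t x * pd (ug2 t) i x
          + pd (ρ t) i x * x 2 + ρ t x * (Pi.single i 1 : E3) 2) := by
    intro i
    have h : HasFDerivAt (fun y => (p t y + geoEnergyDensity ug1 ug2 ρ t y) * u t y i) _ x :=
      ((dx hp).add (((((dx hug1).pow 2).add ((dx hug2).pow 2)).const_mul (1/2)).add
        ((dx hρ).mul hx2))).mul (dx (w := fun s y => u s y i) (hu i))
    simp only [pd, h.fderiv]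
    simp [geoEnergyDensity]
    ring
  rw [het]
  simp_rw [hpd]
  obtain ⟨h0, h1, h2⟩ := heq5
  simp only [lagD, Fin.sum_univ_three] at heq1 heq2 heq3 heq4 ⊢
  have s0 : (Pi.single 0 1 : E3) 2 = 0 := by simp
  have s1 : (Pi.single 1 1 : E3) 2 = 0 := by simp
  have s2 : (Pi.single 2 1 : E3) 2 = 1 := by simp
  rw [s0, s1, s2, h0, h1, h2]
  rw [h0] at heq1
  rw [h1] at heq2
  linear_combination ug1 t x * heq1 + ug2 t x * heq2 + x 2 * heq3
    + (p t x + geoEnergyDensity ug1 ug2 ρ t x) * heq4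

/-- **Conservation of the geostrophic energy for the incompressible
free-boundary semi-geostrophic system.**  For sufficiently smooth solutions of
the system, with rigid boundary condition `u·n = 0` on the fixed part of the
boundary, and kinematic and pressure conditions on the free surface
`x₃ = h(t,x₁,x₂)`, the energy
`E(t) = ∫_{Ω_h(t)} (½((u₁ᵍ)² + (u₂ᵍ)²) + ρ x₃) dx` is conserved. -/
theorem sg_free_boundary_energy_conservation
    (Ω₂ : Set E2) (τ : ℝ) (hτ : 0 < τ)
    (hΩo : IsOpen Ω₂) (hΩb : Bornology.IsBounded Ω₂)
    -- the lateral boundary of Ω₂ is described by a C¹ defining function g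
    (g : E2 → ℝ) (hg : ContDiff ℝ 1 g)
    (hgΩ : Ω₂ = {z | g z < 0}) (hgfr : frontier Ω₂ = {z | g z = 0})
    (hgnondeg : ∀ z ∈ frontier Ω₂, ∃ i : Fin 2, pd2 g i z ≠ 0)
    -- the fields: full velocity, geostrophic velocity, pressure, density, free boundary
    (u : ℝ → E3 → E3) (ug1 ug2 p ρ : ℝ → E3 → ℝ) (h : ℝ → E2 → ℝ)
    -- smoothness of the solution
    (hu : ∀ i : Fin 3, ContDiff ℝ (⊤ : ℕ∞) (fun q : ℝ × E3 => u q.1 q.2 i))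
    (hug1 : ContDiff ℝ (⊤ : ℕ∞) (fun q : ℝ × E3 => ug1 q.1 q.2))
    (hug2 : ContDiff ℝ (⊤ : ℕ∞) (fun q : ℝ × E3 => ug2 q.1 q.2))
    (hp : ContDiff ℝ (⊤ : ℕ∞) (fun q : ℝ × E3 => p q.1 q.2))
    (hρ : ContDiff ℝ (⊤ : ℕ∞) (fun q : ℝ × E3 => ρ q.1 q.2))
    (hh : ContDiff ℝ (⊤ : ℕ∞) (fun q : ℝ × E2 => h q.1 q.2))
    (hhnn : ∀ t z, 0 ≤ h t z)
    -- the semi-geostrophic equations in Ω_h(t):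
    -- momentum equations
    (heq1 : ∀ t ∈ Ico (0:ℝ) τ, ∀ x ∈ domH Ω₂ (h t),
      lagD u ug1 t x - u t x 1 + pd (p t) 0 x = 0)
    (heq2 : ∀ t ∈ Ico (0:ℝ) τ, ∀ x ∈ domH Ω₂ (h t),
      lagD u ug2 t x + u t x 0 + pd (p t) 1 x = 0)
    -- transport of the density
    (heq3 : ∀ t ∈ Ico (0:ℝ) τ, ∀ x ∈ domH Ω₂ (h t), lagD u ρ t x = 0)
    -- incompressibility
    (heq4 : ∀ t ∈ Ico (0:ℝ) τ, ∀ x ∈ domH Ω₂ (h t),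
      (∑ i, pd (fun y => u t y i) i x) = 0)
    -- geostrophic and hydrostatic balance
    (heq5 : ∀ t ∈ Ico (0:ℝ) τ, ∀ x ∈ domH Ω₂ (h t),
      pd (p t) 0 x = ug2 t x ∧ pd (p t) 1 x = -(ug1 t x) ∧ pd (p t) 2 x = -(ρ t x))
    -- rigid boundary condition on the flat bottom x₃ = 0
    (hbc_bottom : ∀ t ∈ Ico (0:ℝ) τ, ∀ x : E3,
      proj2 x ∈ Ω₂ → x 2 = 0 → u t x 2 = 0)
    -- rigid boundary condition u·n = 0 on the lateral boundary
    (hbc_side : ∀ t ∈ Ico (0:ℝ) τ, ∀ x : E3, proj2 x ∈ frontier Ω₂ →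
      0 ≤ x 2 → x 2 ≤ h t (proj2 x) →
      u t x 0 * pd2 g 0 (proj2 x) + u t x 1 * pd2 g 1 (proj2 x) = 0)
    -- kinematic condition on the free surface
    (hbc_kin : ∀ t ∈ Ico (0:ℝ) τ, ∀ z ∈ Ω₂,
      deriv (fun s => h s z) t
        + u t ![z 0, z 1, h t z] 0 * pd2 (h t) 0 z
        + u t ![z 0, z 1, h t z] 1 * pd2 (h t) 1 z
        = u t ![z 0, z 1, h t z] 2)
    -- pressure condition p = 0 on the free surface
    (hbc_p : ∀ t ∈ Ico (0:ℝ) τ, ∀ z ∈ Ω₂, p t ![z 0, z 1, h t z] = 0) :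
    -- conclusion: dE/dt = 0
    ∀ t ∈ Ioo (0:ℝ) τ,
      HasDerivAt
        (fun s => ∫ x in domH Ω₂ (h s),
          ((1/2) * ((ug1 s x)^2 + (ug2 s x)^2) + ρ s x * x 2))
        0 t := by
  intro t ht
  have htI : t ∈ Ico (0 : ℝ) τ := ⟨ht.1.le, ht.2⟩
  have h1top : ((1 : ℕ∞) : WithTop ℕ∞) ≤ ((⊤ : ℕ∞) : WithTop ℕ∞) := by exact_mod_cast le_top
  replace hu := fun i => (hu i).of_le h1top
  replace hug1 := hug1.of_le h1top
  replace hug2 := hug2.of_le h1top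
  replace hp := hp.of_le h1top
  replace hρ := hρ.of_le h1top
  replace hh := hh.of_le h1top
  set e : ℝ → E3 → ℝ := geoEnergyDensity ug1 ug2 ρ with he
  have hec : ContDiff ℝ 1 (fun q : ℝ × E3 => e q.1 q.2) :=
    contDiff_geoEnergyDensity hug1 hug2 hρ
  set f : (ℝ × E2) × ℝ → ℝ := fun q => e q.1.1 (vertLift (q.1.2, q.2)) with hf
  have hfc : ContDiff ℝ 1 f := hec.comp (contDiff_fst.fst.prodMk
    (vertLift.contDiff.comp (contDiff_fst.snd.prodMk contDiff_snd)))
  obtain ⟨hJc, hJd⟩ := contDiff_fderiv_integral_to hfc hh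
  set J : ℝ × E2 → ℝ := fun q => ∫ r in (0 : ℝ)..h q.1 q.2, f (q, r) with hJ
  have hE : (fun s => ∫ x in domH Ω₂ (h s),
      ((1/2) * ((ug1 s x)^2 + (ug2 s x)^2) + ρ s x * x 2)) = fun s => ∫ z in Ω₂, J (s, z) :=
    funext fun s => setIntegral_domH_eq hΩo hΩb (contDiff_slice_right hh s).continuous (hhnn s)
      (contDiff_slice_right hec s).continuous
  rw [hE]
  have hder := (hasFDerivAt_setIntegral_of_contDiff volume hJc hΩo.measurableSet hΩb t).hasDerivAt
  have hJint : IntegrableOn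
      (fun z => (fderiv ℝ J (t, z)).comp (ContinuousLinearMap.inl ℝ ℝ E2)) Ω₂ := by
    have hc : Continuous fun z => (fderiv ℝ J (t, z)).comp (ContinuousLinearMap.inl ℝ ℝ E2) :=
      ((hJc.continuous_fderiv one_ne_zero).comp (Continuous.prodMk_right t)).clm_comp
        continuous_const
    exact (hc.continuousOn.integrableOn_compact hΩb.isCompact_closure).mono_set subset_closure
  rw [ContinuousLinearMap.integral_apply hJint] at hder
  convert hder using 1
  set F : Fin 3 → E3 → ℝ := fun i y => (p t y + e t y) * u t y i with hF
  have hFc : ∀ i, ContDiff ℝ 1 (F i) := fun i =>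
    ((contDiff_slice_right hp t).add (contDiff_slice_right hec t)).mul
      (contDiff_slice_right (w := fun s y => u s y i) (hu i) t)
  have hFL : ∀ i, ContDiff ℝ 1 (fun q : E2 × ℝ => F i (vertLift q)) := fun i =>
    (hFc i).comp vertLift.contDiff
  have hpdF : ∀ i j, Continuous (pd (F i) j) := fun i j =>
    ((hFc i).continuous_fderiv one_ne_zero).clm_apply continuous_const
  have hht : ContDiff ℝ 1 (h t) := contDiff_slice_right hh t
  have hG := fun i => contDiff_fderiv_integral_to (hFL i) hht
  set G : Fin 2 → E2 → ℝ := fun i z => ∫ r in (0 : ℝ)..h t z, F i.castSucc (vertLift (z, r))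
    with hGdef
  have hG0 : ∀ z, pd2 (G 0) 0 z = (∫ r in (0 : ℝ)..h t z, pd (F 0) 0 (vertLift (z, r)))
      + F 0 (vertLift (z, h t z)) * pd2 (h t) 0 z := by
    intro z
    have := (hG 0).2 z (Pi.single 0 1)
    simp only [fderiv_comp_vertLift ((hFc 0).differentiable one_ne_zero),
      vertLift_single_zero] at this
    exact this
  have hG1 : ∀ z, pd2 (G 1) 1 z = (∫ r in (0 : ℝ)..h t z, pd (F 1) 1 (vertLift (z, r)))
      + F 1 (vertLift (z, h t z)) * pd2 (h t) 1 z := by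
    intro z
    have := (hG 1).2 z (Pi.single 1 1)
    simp only [fderiv_comp_vertLift ((hFc 1).differentiable one_ne_zero),
      vertLift_single_one] at this
    exact this
  have hdiv : ∫ z in Ω₂, ∑ i, pd2 (G i) i z = 0 := by
    refine setIntegral_div_eq_zero_of_tangent hΩb hg hgΩ hgfr hgnondeg
      (fun i => (hG i.castSucc).1) fun z hz => ?_
    rw [Fin.sum_univ_two]
    simp only [hGdef]
    rw [← intervalIntegral.integral_mul_const, ← intervalIntegral.integral_mul_const,
      ← intervalIntegral.integral_add]
    · rw [intervalIntegral.integral_congr (g := fun _ => (0 : ℝ))]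
      · simp
      · intro r hr
        rw [uIcc_of_le (hhnn t z)] at hr
        have := hbc_side t htI (vertLift (z, r)) (by rwa [proj2_vertLift]) hr.1
          (by rw [proj2_vertLift]; exact hr.2)
        rw [proj2_vertLift] at this
        show (p t _ + e t _) * u t (vertLift (z, r)) 0 * pd2 g 0 z
          + (p t _ + e t _) * u t (vertLift (z, r)) 1 * pd2 g 1 z = 0
        linear_combination (p t (vertLift (z, r)) + e t (vertLift (z, r))) * this
    all_goals
      exact Continuous.intervalIntegrable (((hFL _).continuous.comp
        (Continuous.prodMk_right z)).mul continuous_const) _ _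
  rw [← neg_zero, ← hdiv, ← integral_neg]
  refine setIntegral_congr_fun hΩo.measurableSet fun z hz => ?_
  have hbal : ∀ r ∈ Icc 0 (h t z), deriv (fun s => e s (vertLift (z, r))) t
      + pd (F 0) 0 (vertLift (z, r)) + pd (F 1) 1 (vertLift (z, r))
      + pd (F 2) 2 (vertLift (z, r)) = 0 := by
    intro r hr
    have hx : vertLift (z, r) ∈ domH Ω₂ (h t) := by
      refine ⟨?_, hr.1, ?_⟩
      · rwa [proj2_vertLift]
      · rw [proj2_vertLift]; exact hr.2
    have := geoEnergyDensity_balance hu hug1 hug2 hp hρ (heq1 t htI _ hx) (heq2 t htI _ hx)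
      (heq3 t htI _ hx) (heq4 t htI _ hx) (heq5 t htI _ hx)
    rw [Fin.sum_univ_three] at this
    linear_combination this
  have hbot : F 2 (vertLift (z, 0)) = 0 := by
    have := hbc_bottom t htI (vertLift (z, 0)) (by rwa [proj2_vertLift]) rfl
    simp only [hF, this, mul_zero]
  have hFTC : ∫ r in (0 : ℝ)..h t z, pd (F 2) 2 (vertLift (z, r)) = F 2 (vertLift (z, h t z)) := by
    rw [intervalIntegral.integral_eq_sub_of_hasDerivAt (f := fun r => F 2 (vertLift (z, r))),
      hbot, sub_zero]
    · intro r _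
      have hl : HasDerivAt (fun r => vertLift (z, r)) (vertLift (0, 1)) r :=
        vertLift.hasFDerivAt.comp_hasDerivAt r ((hasDerivAt_const r z).prodMk (hasDerivAt_id r))
      rw [vertLift_zero_one] at hl
      exact ((hFc 2).differentiable one_ne_zero _).hasFDerivAt.comp_hasDerivAt r hl
    · exact ((hpdF 2 2).comp (vertLift.continuous.comp
        (Continuous.prodMk_right z))).intervalIntegrable _ _
  have hft : ∀ r, fderiv ℝ f ((t, z), r) ((1, 0), 0)
      = deriv (fun s => e s (vertLift (z, r))) t := by
    intro r
    have hl : HasDerivAt (fun s : ℝ => (((s, z), r) : (ℝ × E2) × ℝ)) ((1, 0), 0) t :=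
      ((hasDerivAt_id t).prodMk (hasDerivAt_const t z)).prodMk (hasDerivAt_const t r)
    have hd : HasDerivAt (fun s => e s (vertLift (z, r))) _ t :=
      HasFDerivAt.comp_hasDerivAt (l := f) t
        ((hfc.differentiable one_ne_zero) ((t, z), r)).hasFDerivAt hl
    exact hd.deriv.symm
  have hJt : fderiv ℝ J (t, z) (1, 0)
      = (∫ r in (0 : ℝ)..h t z, deriv (fun s => e s (vertLift (z, r))) t)
        + e t (vertLift (z, h t z)) * deriv (fun s => h s z) t := by
    rw [hJd (t, z) (1, 0), fderiv_time_eq_deriv hh]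
    simp only [hft]
    rfl
  have hsum : ∫ r in (0 : ℝ)..h t z, deriv (fun s => e s (vertLift (z, r))) t
      = -((∫ r in (0 : ℝ)..h t z, pd (F 0) 0 (vertLift (z, r)))
        + (∫ r in (0 : ℝ)..h t z, pd (F 1) 1 (vertLift (z, r)))
        + ∫ r in (0 : ℝ)..h t z, pd (F 2) 2 (vertLift (z, r))) := by
    have hi : ∀ i, IntervalIntegrable (fun r => pd (F i) i (vertLift (z, r))) volume 0 (h t z) :=
      fun i => ((hpdF i i).comp (vertLift.continuous.comp
        (Continuous.prodMk_right z))).intervalIntegrable _ _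
    rw [← intervalIntegral.integral_add (hi 0) (hi 1),
      ← intervalIntegral.integral_add ((hi 0).add (hi 1)) (hi 2), ← intervalIntegral.integral_neg]
    refine intervalIntegral.integral_congr fun r hr => ?_
    rw [uIcc_of_le (hhnn t z)] at hr
    have := hbal r hr
    linear_combination this
  have hkin := hbc_kin t htI z hz
  have hpz := hbc_p t htI z hz
  rw [← vertLift_apply] at hkin hpz
  show -∑ i, pd2 (G i) i z = fderiv ℝ J (t, z) (1, 0)
  rw [hJt, hsum, hFTC, Fin.sum_univ_two, hG0, hG1]
  simp only [hF, hpz, zero_add]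
  linear_combination (-e t (vertLift (z, h t z))) * hkin
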